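/- arXiv:1612.08394 — 6 statements merged into one kernel-verified Lean document; each statement's English description precedes it below -/
import Mathlib

section
/- Suppose α is irrational. Then the map φ(x, ω) = (A·x + h(ω), ω + α) is ergodic with respect to the Haar probability measure on 𝕋² × 𝕋: every measurable set E with φ⁻¹(E) = E (up to null sets) has Haar measure 0 or 1. (Part of Lemma 5.1.) -/
open MeasureTheory

/-- 𝕋 = ℝ/ℤ -/
abbrev 𝕋 : Type := UnitAddCircle

/-- 𝕋² = ℝ²/ℤ², realized as 𝕋 × 𝕋 -/
abbrev 𝕋2 : Type := 𝕋 × 𝕋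

/-- The action of the integer matrix A = [[1,1],[2,1]] on 𝕋² = ℝ²/ℤ². -/
noncomputable def Amul (x : 𝕋2) : 𝕋2 := (x.1 + x.2, x.1 + x.1 + x.2)

/-- The quasi-periodically forced system φ(x, ω) = (A·x + h(ω), ω + α). -/
noncomputable def phi (α : ℝ) (h : 𝕋 → 𝕋2) (p : 𝕋2 × 𝕋) : 𝕋2 × 𝕋 :=
  (Amul p.1 + h p.2, p.2 + (α : 𝕋))

open scoped ComplexConjugate BoundedContinuousFunction

theorem MeasureTheory.Measure.ext_of_integral_eq_on_submonoid {X : Type*}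
    [TopologicalSpace X] [PolishSpace X]
    [MeasurableSpace X] [BorelSpace X] {P Q : Measure X} [IsFiniteMeasure P] [IsFiniteMeasure Q]
    (S : Submonoid (X →ᵇ ℂ)) (hstar : ∀ f ∈ S, star f ∈ S)
    (hsep : ∀ x y, x ≠ y → ∃ f ∈ S, f x ≠ f y)
    (heq : ∀ f ∈ S, ∫ x, f x ∂P = ∫ x, f x ∂Q) : P = Q := by
  refine ext_of_forall_mem_subalgebra_integral_eq_of_polish (𝕜 := ℂ)
    (A := StarAlgebra.adjoin ℂ (S : Set (X →ᵇ ℂ))) ?_ ?_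
  · intro x y hxy
    obtain ⟨f, hf, hne⟩ := hsep x y hxy
    exact ⟨_, ⟨_, ⟨f, StarAlgebra.subset_adjoin ℂ _ hf, rfl⟩, rfl⟩, hne⟩
  · intro g hg
    have hunion : (S : Set (X →ᵇ ℂ)) ∪ star (S : Set (X →ᵇ ℂ)) = S := by
      refine Set.union_eq_left.2 fun f hf => ?_
      simpa using hstar _ (Set.mem_star.1 hf)
    have hspan : g ∈ Submodule.span ℂ (S : Set (X →ᵇ ℂ)) := by
      have := StarAlgebra.adjoin_eq_span (R := ℂ) (S : Set (X →ᵇ ℂ))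
      rw [hunion, Submonoid.closure_eq] at this
      rw [← this]
      exact hg
    clear hg
    induction hspan using Submodule.span_induction with
    | mem f hf => exact heq f hf
    | zero => simp
    | add f g _ _ hf hg =>
      simp only [BoundedContinuousFunction.coe_add, Pi.add_apply]
      rw [integral_add (f.integrable P) (g.integrable P),
        integral_add (f.integrable Q) (g.integrable Q), hf, hg]
    | smul c f _ hf => simp [integral_const_mul, hf]

theorem setIntegral_comp_iterate {X : Type*} [MeasurableSpace X] {μ : Measure X} {φ : X → X}
    (hφ : MeasurePreserving φ μ μ) {E : Set X} (hE : MeasurableSet E) (hinv : φ ⁻¹' E =ᵐ[μ] E)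
    {u : X → ℂ} (hu : Measurable u) (n : ℕ) :
    ∫ x in E, u (φ^[n] x) ∂μ = ∫ x in E, u x ∂μ := by
  induction n with
  | zero => rfl
  | succ n ih =>
    calc ∫ x in E, u (φ^[n] (φ x)) ∂μ
        = ∫ x in φ ⁻¹' E, u (φ^[n] (φ x)) ∂μ := by rw [Measure.restrict_congr_set hinv]
      _ = ∫ x in E, u (φ^[n] x) ∂μ := by
        have hmeas : Measurable fun x => u (φ^[n] x) := hu.comp (hφ.measurable.iterate n)
        rw [← (hφ.restrict_preimage hE).map_eq,
          integral_map hφ.measurable.aemeasurable hmeas.aestronglyMeasurable]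
      _ = ∫ x in E, u x ∂μ := ih

theorem setIntegral_eq_zero_of_iterates_orthogonal {X : Type*} [MeasurableSpace X] {μ : Measure X}
    [IsProbabilityMeasure μ] {φ : X → X} (hφ : MeasurePreserving φ μ μ) {E : Set X}
    (hE : MeasurableSet E) (hinv : φ ⁻¹' E =ᵐ[μ] E) {u : X → ℂ} (hu : Measurable u)
    (hnorm : ∀ x, ‖u x‖ = 1)
    (horth : ∀ n, n ≠ 0 → ∫ x, u (φ^[n] x) * conj (u x) ∂μ = 0) :
    ∫ x in E, u x ∂μ = 0 := by
  have hmeas (n : ℕ) : Measurable fun x => u (φ^[n] x) := hu.comp (hφ.measurable.iterate n)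
  have hLp (n : ℕ) : MemLp (fun x => u (φ^[n] x)) 2 μ :=
    .of_bound (hmeas n).aestronglyMeasurable 1 (.of_forall fun x => (hnorm _).le)
  have hinner (i j : ℕ) : inner ℂ (hLp i).toLp (hLp j).toLp
      = ∫ x, u (φ^[j] x) * conj (u (φ^[i] x)) ∂μ := by
    rw [L2.inner_def]
    refine integral_congr_ae ?_
    filter_upwards [(hLp i).coeFn_toLp, (hLp j).coeFn_toLp] with x hi hj
    rw [hi, hj]; rfl
  have hlt (i j : ℕ) (hij : i < j) : inner ℂ (hLp i).toLp (hLp j).toLp = (0 : ℂ) := by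
    have hmap := integral_map (μ := μ) (hφ.iterate i).measurable.aemeasurable
      (f := fun x => u (φ^[j - i] x) * conj (u x))
      ((hmeas _).mul (Complex.continuous_conj.measurable.comp hu)).aestronglyMeasurable
    rw [(hφ.iterate i).map_eq, horth (j - i) (by omega)] at hmap
    rw [hinner, hmap]
    simp_rw [← Function.iterate_add_apply, Nat.sub_add_cancel hij.le]
  have hon : Orthonormal ℂ fun n => (hLp n).toLp := by
    rw [orthonormal_iff_ite]
    intro i j
    split_ifs with hij
    · subst hij
      rw [hinner]
      simp [Complex.mul_conj, Complex.normSq_eq_norm_sq, hnorm]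
    · rcases lt_or_gt_of_ne hij with hij | hij
      · exact hlt i j hij
      · rw [← inner_conj_symm, hlt j i hij, map_zero]
  have hcoef (n : ℕ) : ‖(inner ℂ (hLp n).toLp
      (indicatorConstLp 2 hE (measure_ne_top μ E) (1 : ℂ)) : ℂ)‖ ^ 2 = ‖∫ x in E, u x ∂μ‖ ^ 2 := by
    rw [norm_inner_symm, L2.inner_indicatorConstLp_one, ← setIntegral_comp_iterate hφ hE hinv hu n]
    congr 2
    exact setIntegral_congr_ae hE ((hLp n).coeFn_toLp.mono fun x hx _ => hx)
  have hsum := hon.inner_products_summable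
    (indicatorConstLp 2 hE (measure_ne_top μ E) (1 : ℂ))
  simpa [hcoef, summable_const_iff] using hsum

instance : IsProbabilityMeasure (volume : Measure 𝕋) := ⟨UnitAddCircle.measure_univ⟩

instance : IsProbabilityMeasure (volume : Measure (𝕋2 × 𝕋)) :=
  inferInstanceAs (IsProbabilityMeasure ((volume.prod volume).prod volume))

instance : (volume : Measure 𝕋2).IsAddHaarMeasure :=
  inferInstanceAs (volume.prod volume).IsAddHaarMeasure

theorem integral_fourier_eq_zero {n : ℤ} (hn : n ≠ 0) : ∫ x : 𝕋, fourier n x = 0 := by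
  have h := integral_eq_zero_of_add_right_eq_neg (μ := (volume : Measure 𝕋))
    (fourier_add_half_inv_index (T := 1) hn one_pos)
  exact h

/-- The character `(x, ω) ↦ e(k₁ x₁ + k₂ x₂ + k₃ ω)` of `𝕋² × 𝕋`. -/
noncomputable def torusChar (k : (ℤ × ℤ) × ℤ) : (𝕋2 × 𝕋) →ᵇ ℂ :=
  .mkOfCompact ⟨fun p => fourier k.1.1 p.1.1 * fourier k.1.2 p.1.2 * fourier k.2 p.2, by fun_prop⟩

theorem torusChar_apply (k : (ℤ × ℤ) × ℤ) (p : 𝕋2 × 𝕋) :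
    torusChar k p = fourier k.1.1 p.1.1 * fourier k.1.2 p.1.2 * fourier k.2 p.2 := rfl

theorem norm_fourier_apply (n : ℤ) (x : 𝕋) : ‖fourier n x‖ = 1 := Circle.norm_coe _

theorem norm_torusChar_apply (k : (ℤ × ℤ) × ℤ) (p : 𝕋2 × 𝕋) : ‖torusChar k p‖ = 1 := by
  simp only [torusChar_apply, norm_mul, norm_fourier_apply, mul_one]

/-- The characters `torusChar k` form a monoid under multiplication. -/
noncomputable def torusCharHom : Multiplicative ((ℤ × ℤ) × ℤ) →* ((𝕋2 × 𝕋) →ᵇ ℂ) where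
  toFun k := torusChar k.toAdd
  map_one' := by
    ext p
    simp [torusChar_apply]
  map_mul' k l := by
    ext p
    simp only [BoundedContinuousFunction.coe_mul, Pi.mul_apply, torusChar_apply, toAdd_mul,
      Prod.fst_add, Prod.snd_add, fourier_add]
    ring

theorem star_torusChar (k : (ℤ × ℤ) × ℤ) : star (torusChar k) = torusChar (-k) := by
  ext p
  simp only [BoundedContinuousFunction.star_apply, torusChar_apply, Prod.fst_neg, Prod.snd_neg,
    fourier_neg, star_mul', Complex.star_def]

theorem exists_torusChar_ne {p q : 𝕋2 × 𝕋} (hpq : p ≠ q) :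
    ∃ k, torusChar k p ≠ torusChar k q := by
  by_contra! hk
  have hinj {x y : 𝕋} (hxy : fourier 1 x = fourier 1 y) : x = y :=
    AddCircle.injective_toCircle one_ne_zero (Subtype.coe_injective (by
      simpa only [fourier_one] using hxy))
  refine hpq (Prod.ext (Prod.ext (hinj ?_) (hinj ?_)) (hinj ?_))
  · simpa [torusChar_apply] using hk ((1, 0), 0)
  · simpa [torusChar_apply] using hk ((0, 1), 0)
  · simpa [torusChar_apply] using hk ((0, 0), 1)

theorem measure_ext_of_integral_torusChar {P Q : Measure (𝕋2 × 𝕋)} [IsFiniteMeasure P]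
    [IsFiniteMeasure Q] (heq : ∀ k, ∫ p, torusChar k p ∂P = ∫ p, torusChar k p ∂Q) : P = Q := by
  refine Measure.ext_of_integral_eq_on_submonoid (MonoidHom.mrange torusCharHom) ?_ ?_ ?_
  · rintro _ ⟨k, rfl⟩
    exact ⟨k⁻¹, (star_torusChar _).symm⟩
  · intro p q hpq
    obtain ⟨k, hk⟩ := exists_torusChar_ne hpq
    exact ⟨_, ⟨.ofAdd k, rfl⟩, hk⟩
  · rintro _ ⟨k, rfl⟩
    exact heq _

theorem integral_fourier_mul_fourier_mul_eq_zero {m : ℤ × ℤ} (hm : m ≠ 0) (w : 𝕋 → ℂ) :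
    ∫ p : 𝕋2 × 𝕋, fourier m.1 p.1.1 * fourier m.2 p.1.2 * w p.2 = 0 := by
  have hprod := integral_prod_mul (μ := (volume : Measure 𝕋2)) (ν := (volume : Measure 𝕋))
    (fun x => fourier m.1 x.1 * fourier m.2 x.2) w
  have hprod' := integral_prod_mul (μ := (volume : Measure 𝕋)) (ν := (volume : Measure 𝕋))
    (fourier m.1) (fourier m.2)
  refine hprod.trans (mul_eq_zero_of_left (hprod'.trans ?_) _)
  rw [mul_eq_zero]
  by_cases h1 : m.1 = 0
  · exact .inr (integral_fourier_eq_zero fun h2 => hm (Prod.ext h1 h2))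
  · exact .inl (integral_fourier_eq_zero h1)

theorem integral_torusChar_eq_zero {k : (ℤ × ℤ) × ℤ} (hk : k ≠ 0) :
    ∫ p, torusChar k p = 0 := by
  by_cases hm : k.1 = 0
  · have hprod := integral_prod_mul (μ := (volume : Measure 𝕋2)) (ν := (volume : Measure 𝕋))
      (fun x => fourier k.1.1 x.1 * fourier k.1.2 x.2) (fourier k.2)
    refine hprod.trans (mul_eq_zero_of_right _ (integral_fourier_eq_zero fun h2 => ?_))
    exact hk (Prod.ext hm h2)
  · exact integral_fourier_mul_fourier_mul_eq_zero hm _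

theorem measurePreserving_Amul : MeasurePreserving Amul := by
  let f : 𝕋2 →+ 𝕋2 :=
    { toFun := Amul
      map_zero' := by simp [Amul]
      map_add' := fun x y => by ext <;> simp only [Amul, Prod.fst_add, Prod.snd_add] <;> abel }
  refine AddMonoidHom.measurePreserving (f := f) ?_ ?_ rfl
  · change Continuous Amul
    unfold Amul
    fun_prop
  · intro y
    refine ⟨(y.2 - y.1, y.1 + y.1 - y.2), ?_⟩
    ext <;> simp only [f, Amul, AddMonoidHom.coe_mk, ZeroHom.coe_mk] <;> abel

theorem measurePreserving_phi (α : ℝ) {h : 𝕋 → 𝕋2} (hh : Measurable h) :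
    MeasurePreserving (phi α h) := by
  have hskew : MeasurePreserving (fun q : 𝕋 × 𝕋2 => (q.1 + (α : 𝕋), Amul q.2 + h q.1))
      (volume.prod volume) (volume.prod volume) := by
    refine (measurePreserving_add_right volume (α : 𝕋)).skew_product
      (g := fun ω x => Amul x + h ω) ?_ (.of_forall fun ω => ?_)
    · exact (measurePreserving_Amul.measurable.comp measurable_snd).add (hh.comp measurable_fst)
    · exact ((measurePreserving_add_right volume (h ω)).comp measurePreserving_Amul).map_eq
  exact Measure.measurePreserving_swap.comp (hskew.comp Measure.measurePreserving_swap)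

/-- The action of the transpose of `A` on frequencies. -/
def dualA (m : ℤ × ℤ) : ℤ × ℤ := (m.1 + 2 * m.2, m.1 + m.2)

theorem fourier_mul_fourier_Amul (m : ℤ × ℤ) (x : 𝕋2) :
    fourier m.1 (Amul x).1 * fourier m.2 (Amul x).2
      = (fourier (dualA m).1 x.1 * fourier (dualA m).2 x.2 : ℂ) := by
  simp only [Amul, dualA]
  simp only [fourier_apply, ← Circle.coe_mul, ← AddCircle.toCircle_add]
  congr 2
  module

theorem exists_torusChar_iterate_phi (α : ℝ) (h : 𝕋 → 𝕋2) (k : (ℤ × ℤ) × ℤ) (n : ℕ) :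
    ∃ w : 𝕋 → ℂ, ∀ p, torusChar k ((phi α h)^[n] p)
      = fourier (dualA^[n] k.1).1 p.1.1 * fourier (dualA^[n] k.1).2 p.1.2 * w p.2 := by
  induction n with
  | zero => exact ⟨fourier k.2, fun p => rfl⟩
  | succ n ih =>
    obtain ⟨w, hw⟩ := ih
    refine ⟨fun ω => fourier (dualA^[n] k.1).1 (h ω).1 * fourier (dualA^[n] k.1).2 (h ω).2
      * w (ω + α), fun p => ?_⟩
    have hadd (i : ℤ) (x y : 𝕋) : fourier i (x + y) = (fourier i x * fourier i y : ℂ) := by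
      simp only [fourier_apply, smul_add, AddCircle.toCircle_add, Circle.coe_mul]
    rw [Function.iterate_succ_apply, hw, Function.iterate_succ_apply', ← mul_assoc, ← mul_assoc,
      ← fourier_mul_fourier_Amul]
    simp only [phi, Prod.fst_add, Prod.snd_add, hadd]
    ring

theorem iterate_dualA_ne {m : ℤ × ℤ} (hm : m ≠ 0) {n : ℕ} (hn : n ≠ 0) : dualA^[n] m ≠ m := by
  let z : ℤ × ℤ → ℝ := fun m => m.1 + m.2 * √2
  have hz (m) : z (dualA m) = (1 + √2) * z m := by
    simp only [z, dualA]
    push_cast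
    linear_combination -(m.2 : ℝ) * Real.sq_sqrt (zero_le_two (α := ℝ))
  have hiter : z (dualA^[n] m) = (1 + √2) ^ n * z m := by
    clear hn
    induction n with
    | zero => simp
    | succ n ih => rw [Function.iterate_succ_apply', hz, ih, pow_succ]; ring
  have hzm : z m ≠ 0 := by
    intro h0
    by_cases h2 : m.2 = 0
    · exact hm (Prod.ext (by simpa [z, h2] using h0) h2)
    · exact ((irrational_sqrt_two.intCast_mul h2).intCast_add m.1).ne_zero h0
  intro heq
  rw [heq] at hiter
  have hone : (1 + √2) ^ n = 1 := mul_right_cancel₀ hzm (by rw [← hiter, one_mul])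
  exact (one_lt_pow₀ (by simp) hn).ne' hone

theorem torusChar_phi_of_fst_eq_zero (α : ℝ) (h : 𝕋 → 𝕋2) {k : (ℤ × ℤ) × ℤ} (hk : k.1 = 0)
    (p : 𝕋2 × 𝕋) : torusChar k (phi α h p) = fourier k.2 (α : 𝕋) * torusChar k p := by
  simp only [torusChar_apply, hk, phi, Prod.fst_zero, Prod.snd_zero, fourier_zero, one_mul]
  simp only [fourier_apply, smul_add, AddCircle.toCircle_add, Circle.coe_mul]
  ring

theorem fourier_irrational_ne_one {α : ℝ} (hα : Irrational α) {n : ℤ} (hn : n ≠ 0) :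
    fourier n (α : 𝕋) ≠ 1 := by
  intro h1
  have h0 : n • (α : 𝕋) = 0 :=
    AddCircle.injective_toCircle one_ne_zero (Subtype.coe_injective (by
      simpa [fourier_apply] using h1))
  rw [← AddCircle.coe_zsmul, AddCircle.coe_eq_zero_iff] at h0
  obtain ⟨m, hm⟩ := h0
  refine (hα.intCast_mul hn).ne_int m ?_
  simpa using hm.symm

theorem setIntegral_torusChar_eq_zero {α : ℝ} (hα : Irrational α) {h : 𝕋 → 𝕋2}
    (hh : Measurable h) {E : Set (𝕋2 × 𝕋)} (hE : MeasurableSet E)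
    (hinv : phi α h ⁻¹' E =ᵐ[volume] E) {k : (ℤ × ℤ) × ℤ} (hk : k ≠ 0) :
    ∫ p in E, torusChar k p = 0 := by
  have hφ := measurePreserving_phi α hh
  have hmeas : Measurable (torusChar k) := (torusChar k).continuous.measurable
  by_cases hm : k.1 = 0
  · have hrot := setIntegral_comp_iterate hφ hE hinv hmeas 1
    simp only [Function.iterate_one, torusChar_phi_of_fst_eq_zero α h hm,
      integral_const_mul] at hrot
    by_contra h0
    exact fourier_irrational_ne_one hα (fun h2 => hk (Prod.ext hm h2))
      ((mul_eq_right₀ h0).1 hrot)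
  · refine setIntegral_eq_zero_of_iterates_orthogonal hφ hE hinv hmeas (norm_torusChar_apply k)
      fun n hn => ?_
    obtain ⟨w, hw⟩ := exists_torusChar_iterate_phi α h k n
    rw [← integral_fourier_mul_fourier_mul_eq_zero
      (sub_ne_zero.2 (iterate_dualA_ne hm hn)) fun ω => w ω * fourier (-k.2) ω]
    refine integral_congr_ae (.of_forall fun p => ?_)
    simp only [hw, torusChar_apply, map_mul, ← fourier_neg, sub_eq_add_neg, Prod.fst_add,
      Prod.snd_add, Prod.fst_neg, Prod.snd_neg, fourier_add]
    ring

/-- if α is irrational, then φ(x,ω) = (A·x + h(ω), ω + α) is ergodic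
for the Haar probability measure on 𝕋² × 𝕋: every measurable set E which is
invariant up to null sets (i.e. φ⁻¹(E) ∆ E is null) has measure 0 or 1. -/
theorem phi_ergodic (α : ℝ) (hα : Irrational α) (h : 𝕋 → 𝕋2) (hc : Continuous h)
    (E : Set (𝕋2 × 𝕋)) (hE : MeasurableSet E)
    (hinv : volume (symmDiff ((phi α h) ⁻¹' E) E) = 0) :
    volume E = 0 ∨ volume E = 1 := by
  have hae : phi α h ⁻¹' E =ᵐ[volume] E := measure_symmDiff_eq_zero_iff.1 hinv
  have hmul : volume.restrict E = volume E • (volume : Measure (𝕋2 × 𝕋)) := by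
    have : IsFiniteMeasure (volume E • (volume : Measure (𝕋2 × 𝕋))) :=
      Measure.smul_finite _ (measure_ne_top _ _)
    refine measure_ext_of_integral_torusChar fun k => ?_
    rw [integral_smul_measure]
    by_cases hk : k = 0
    · subst hk
      simp [torusChar_apply, Measure.real]
    · rw [setIntegral_torusChar_eq_zero hα hc.measurable hE hae hk,
        integral_torusChar_eq_zero hk, smul_zero]
  have hsq : volume E = volume E * volume E := by
    simpa using congrArg (fun μ : Measure (𝕋2 × 𝕋) => μ E) hmul
  by_cases h0 : volume E = 0
  · exact .inl h0
  · exact .inr ((ENNReal.mul_eq_left h0 (measure_ne_top _ _)).1 hsq.symm)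
end

section
/- Suppose α is irrational. Then the homeomorphism φ(x, ω) = (A·x + h(ω), ω + α) of 𝕋² × 𝕋 is topologically transitive: there exists a point p ∈ 𝕋² × 𝕋 whose orbit {φⁿ(p) : n ∈ ℤ} is dense in 𝕋² × 𝕋. (Part of Lemma 5.1.) -/
open Filter Topology Set TopologicalSpace

/-- Birkhoff's transitivity theorem: if every nonempty open set is carried by iterates of a
continuous self-map into every other one, some forward orbit is dense. -/
theorem exists_dense_range_iterate {X : Type*} [TopologicalSpace X] [BaireSpace X]
    [SecondCountableTopology X] [Nonempty X] {f : X → X} (hf : Continuous f)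
    (htrans : ∀ U V : Set X, IsOpen U → U.Nonempty → IsOpen V → V.Nonempty →
      ∃ n : ℕ, ∃ x ∈ U, f^[n] x ∈ V) :
    ∃ x, Dense (range fun n : ℕ => f^[n] x) := by
  have hopen (V : countableBasis X) : IsOpen (⋃ n : ℕ, f^[n] ⁻¹' V) :=
    isOpen_iUnion fun n => (isOpen_of_mem_countableBasis V.2).preimage (hf.iterate n)
  have hdense (V : countableBasis X) : Dense (⋃ n : ℕ, f^[n] ⁻¹' (V : Set X)) := by
    refine dense_iff_inter_open.2 fun U hU hUne => ?_
    obtain ⟨n, x, hxU, hxV⟩ := htrans U V hU hUne (isOpen_of_mem_countableBasis V.2)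
      (nonempty_of_mem_countableBasis V.2)
    exact ⟨x, hxU, mem_iUnion.2 ⟨n, hxV⟩⟩
  obtain ⟨x, hx⟩ := (dense_iInter_of_isOpen hopen hdense).nonempty
  refine ⟨x, (isBasis_countableBasis X).dense_iff.2 fun V hV _ => ?_⟩
  obtain ⟨n, hn⟩ := mem_iUnion.1 (mem_iInter.1 hx ⟨V, hV⟩)
  exact ⟨f^[n] x, hn, n, rfl⟩

/-- The one-parameter subgroup of 𝕋² in the expanding eigendirection `(1, √2)` of `A`. -/
noncomputable def unstableLine (t : ℝ) : 𝕋2 := ((t : 𝕋), ((√2 * t : ℝ) : 𝕋))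

theorem continuous_unstableLine : Continuous unstableLine := by
  unfold unstableLine
  exact (AddCircle.continuous_mk' 1).prodMk
    ((AddCircle.continuous_mk' 1).comp (continuous_const.mul continuous_id))

theorem Amul_add (x y : 𝕋2) : Amul (x + y) = Amul x + Amul y := by
  ext <;> simp only [Amul, Prod.fst_add, Prod.snd_add] <;> abel

theorem Amul_unstableLine (t : ℝ) : Amul (unstableLine t) = unstableLine ((1 + √2) * t) := by
  have h2 : √2 * √2 = 2 := Real.mul_self_sqrt (by norm_num)
  ext
  · simp only [Amul, unstableLine, ← AddCircle.coe_add]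
    congr 1
    ring
  · simp only [Amul, unstableLine, ← AddCircle.coe_add]
    congr 1
    linear_combination -t * h2

theorem continuous_phi (α : ℝ) {h : 𝕋 → 𝕋2} (hc : Continuous h) : Continuous (phi α h) := by
  unfold phi Amul
  fun_prop

/-- Every translate of the unstable line is dense in 𝕋². -/
theorem exists_add_unstableLine_mem {W : Set 𝕋2} (hW : IsOpen W) (hne : W.Nonempty) (y : 𝕋2) :
    ∃ t : ℝ, y + unstableLine t ∈ W := by
  obtain ⟨⟨c, d⟩, hcd⟩ := hne
  obtain ⟨s, hs⟩ := QuotientAddGroup.mk_surjective (c - y.1)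
  have hs : ((s : ℝ) : 𝕋) = c - y.1 := hs
  have hdense : DenseRange (· • ((√2 : ℝ) : 𝕋) : ℤ → 𝕋) :=
    AddCircle.denseRange_zsmul_coe_iff.2 (by simpa using irrational_sqrt_two)
  have hW' : IsOpen {z : 𝕋 | (c, y.2 + ((√2 * s : ℝ) : 𝕋) + z) ∈ W} :=
    hW.preimage (by fun_prop)
  obtain ⟨k, hk⟩ := hdense.exists_mem_open hW' ⟨d - (y.2 + ((√2 * s : ℝ) : 𝕋)), by simpa using hcd⟩
  refine ⟨s + k, ?_⟩
  have hk : (c, y.2 + ((√2 * s : ℝ) : 𝕋) + k • ((√2 : ℝ) : 𝕋)) ∈ W := hk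
  convert hk using 1
  ext
  · simp [unstableLine, hs]
  · simp only [unstableLine, Prod.snd_add, mul_add, AddCircle.coe_add, add_assoc]
    rw [mul_comm (√2) (k : ℝ), ← zsmul_eq_mul, AddCircle.coe_zsmul]

/-- Sufficiently long unstable segments meet a given open set, whatever their base point. -/
theorem exists_abs_lt_add_unstableLine_mem {W : Set 𝕋2} (hW : IsOpen W) (hne : W.Nonempty) :
    ∃ L : ℝ, ∀ y, ∃ t, |t| < L ∧ y + unstableLine t ∈ W := by
  obtain ⟨L, hL⟩ := isCompact_univ.elim_directed_cover
    (fun L : ℝ => ⋃ t ∈ {t : ℝ | |t| < L}, {y : 𝕋2 | y + unstableLine t ∈ W})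
    (fun L => isOpen_biUnion fun t _ => hW.preimage (continuous_add_const _))
    (fun y _ => by
      obtain ⟨t, ht⟩ := exists_add_unstableLine_mem hW hne y
      exact mem_iUnion.2 ⟨|t| + 1, mem_iUnion₂.2 ⟨t, lt_add_one |t|, ht⟩⟩)
    (Monotone.directed_le fun L L' hLL' =>
      biUnion_subset_biUnion_left fun _ ht => mem_ofPred.2 ((mem_ofPred.1 ht).trans_le hLL'))
  refine ⟨L, fun y => ?_⟩
  simpa using hL (mem_univ y)

/-- Iterates of `phi` expand unstable segments by `1 + √2`. -/
theorem exists_iterate_phi_add_unstableLine (α : ℝ) (h : 𝕋 → 𝕋2) (x : 𝕋2) (ω : 𝕋) (n : ℕ) :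
    ∃ y, ∀ t, (phi α h)^[n] (x + unstableLine t, ω) =
      (y + unstableLine ((1 + √2) ^ n * t), ω + n • (α : 𝕋)) := by
  induction n with
  | zero => exact ⟨x, fun t => by simp⟩
  | succ n ih =>
    obtain ⟨y, hy⟩ := ih
    refine ⟨Amul y + h (ω + n • (α : 𝕋)), fun t => ?_⟩
    rw [Function.iterate_succ_apply', hy, phi, Amul_add, Amul_unstableLine, succ_nsmul,
      pow_succ', mul_assoc, add_assoc ω, add_right_comm]

/-- Forward iterates of `phi` carry every nonempty open set into every other one. -/
theorem exists_iterate_phi_mem {α : ℝ} (hα : Irrational α) (h : 𝕋 → 𝕋2) (U V : Set (𝕋2 × 𝕋))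
    (hU : IsOpen U) (hUne : U.Nonempty) (hV : IsOpen V) (hVne : V.Nonempty) :
    ∃ n : ℕ, ∃ p ∈ U, (phi α h)^[n] p ∈ V := by
  obtain ⟨⟨x, ω⟩, hxω⟩ := hUne
  obtain ⟨⟨z, η⟩, hzη⟩ := hVne
  obtain ⟨W, I, hW, hI, hzW, hηI, hWI⟩ := isOpen_prod_iff.1 hV z η hzη
  obtain ⟨L, hL⟩ := exists_abs_lt_add_unstableLine_mem hW ⟨z, hzW⟩
  have hUline : ∀ᶠ t in 𝓝 (0 : ℝ), (x + unstableLine t, ω) ∈ U := by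
    have hcont : Continuous fun t : ℝ => (x + unstableLine t, ω) :=
      (continuous_const.add continuous_unstableLine).prodMk continuous_const
    refine hcont.continuousAt.eventually_mem (hU.mem_nhds ?_)
    have h0 : unstableLine 0 = 0 := by simp [unstableLine]
    simpa [h0] using hxω
  obtain ⟨ε, hε, hεU⟩ := Metric.eventually_nhds_iff.1 hUline
  have hlarge : ∀ᶠ n : ℕ in atTop, L / ε < (1 + √2) ^ n :=
    (tendsto_pow_atTop_atTop_of_one_lt (by simp)).eventually_gt_atTop _
  have hfreq : ∃ᶠ n : ℕ in atTop, ω + n • (α : 𝕋) ∈ I := by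
    have hdense : DenseRange (· • (α : 𝕋) : ℤ → 𝕋) :=
      AddCircle.denseRange_zsmul_coe_iff.2 (by simpa using hα)
    have hcl : MapClusterPt (η - ω) atTop (· • (α : 𝕋) : ℕ → 𝕋) :=
      ((mapClusterPt_atTop_nsmul_tfae (η - ω) (α : 𝕋)).out 0 3).2 (hdense _)
    exact hcl.frequently ((continuous_const_add ω).continuousAt.preimage_mem_nhds
      (hI.mem_nhds (by simpa using hηI)))
  obtain ⟨n, hnI, hn⟩ := (hfreq.and_eventually hlarge).exists
  obtain ⟨y, hy⟩ := exists_iterate_phi_add_unstableLine α h x ω n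
  obtain ⟨t, htL, htW⟩ := hL y
  have hpos : 0 < (1 + √2) ^ n := by positivity
  refine ⟨n, (x + unstableLine (t / (1 + √2) ^ n), ω), hεU ?_, hWI ?_⟩
  · rw [Real.dist_0_eq_abs, abs_div, abs_of_pos hpos, div_lt_iff₀ hpos]
    exact htL.trans (by rwa [div_lt_iff₀' hε] at hn)
  · rw [hy, mul_div_cancel₀ _ hpos.ne']
    exact ⟨htW, hnI⟩

/-- if α is irrational, the homeomorphism φ(x,ω) = (A·x + h(ω), ω + α)
of 𝕋² × 𝕋 is topologically transitive: there is a point whose two-sided orbit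
{φⁿ(p) : n ∈ ℤ} is dense in 𝕋² × 𝕋.  (The bijection φ is packaged as a
permutation ψ of 𝕋² × 𝕋 agreeing with φ, so that ℤ-powers make sense.) -/
theorem phi_transitive (α : ℝ) (hα : Irrational α) (h : 𝕋 → 𝕋2) (hc : Continuous h)
    (ψ : Equiv.Perm (𝕋2 × 𝕋)) (hψ : ∀ p, ψ p = phi α h p) :
    ∃ p : 𝕋2 × 𝕋, Dense (Set.range fun n : ℤ => (ψ ^ n) p) := by
  obtain ⟨p, hp⟩ := exists_dense_range_iterate (continuous_phi α hc) (exists_iterate_phi_mem hα h)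
  have hψ' : ⇑ψ = phi α h := funext hψ
  refine ⟨p, hp.mono ?_⟩
  rintro _ ⟨n, rfl⟩
  exact ⟨n, by simp [← hψ', Equiv.Perm.iterate_eq_pow]⟩
end

section
/- Let A be a d×d integer matrix, n ≥ 1 an integer, α ∈ ℝ, and k, m ∈ ℤᵈ. Suppose G : ℝ → ℝᵈ and H : ℝ → ℝᵈ are continuous with G(t + 1) = G(t) + k and H(t + 1) = H(t) + m for all t ∈ ℝ, and suppose that for every t ∈ ℝ the vector G(t + nα) − Aⁿ·G(t) − Σ_{i=0}^{n−1} A^{n−1−i}·H(t + iα) lies in ℤᵈ. Then (I − Aⁿ)·k = (I + A + ⋯ + A^{n−1})·m. (Degree identity from the proof of Lemma 5.2.) -/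
open Matrix

/-- An integer-valued function on a preconnected space is constant if its composition with the
inclusion of `ℤ` in `ℝ` is continuous. -/
theorem intValued_eq_of_continuous {X : Type*} [TopologicalSpace X] [PreconnectedSpace X]
    {f : X → ℤ} (hf : Continuous fun x => (f x : ℝ)) (x y : X) : f x = f y :=
  PreconnectedSpace.constant inferInstance
    (Int.isClosedEmbedding_coe_real.isInducing.continuous_iff.2 hf)

/-- Casting an integer matrix-vector product to the reals. -/
theorem map_intCast_mulVec {m n : Type*} [Fintype n] (B : Matrix m n ℤ) (v : n → ℤ) :
    B.map (Int.cast : ℤ → ℝ) *ᵥ (fun i => (v i : ℝ)) = fun j => (((B *ᵥ v) j : ℤ) : ℝ) := by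
  ext j
  simp [mulVec, dotProduct]


/-- degree identity from the proof of Lemma 5.2: if G, H : ℝ → ℝᵈ are
continuous lifts of degree vectors k, m (i.e. G(t+1) = G(t) + k, H(t+1) = H(t) + m),
and for every t the vector G(t+nα) − AⁿG(t) − Σ_{i=0}^{n−1} A^{n−1−i} H(t+iα) is an
integer vector, then (I − Aⁿ)k = (I + A + ⋯ + A^{n−1})m. -/
theorem degree_identity (d : ℕ) (A : Matrix (Fin d) (Fin d) ℤ) (n : ℕ) (hn : 1 ≤ n)
    (α : ℝ) (k m : Fin d → ℤ)
    (G H : ℝ → Fin d → ℝ) (hG : Continuous G) (hH : Continuous H)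
    (hGdeg : ∀ t : ℝ, G (t + 1) = G t + fun i => (k i : ℝ))
    (hHdeg : ∀ t : ℝ, H (t + 1) = H t + fun i => (m i : ℝ))
    (hint : ∀ t : ℝ, ∃ z : Fin d → ℤ,
      G (t + n * α) - (A ^ n).map (Int.cast : ℤ → ℝ) *ᵥ G t
          - ∑ i ∈ Finset.range n, (A ^ (n - 1 - i)).map (Int.cast : ℤ → ℝ) *ᵥ H (t + i * α)
        = fun j => (z j : ℝ)) :
    ((1 : Matrix (Fin d) (Fin d) ℤ) - A ^ n) *ᵥ k
      = (∑ i ∈ Finset.range n, A ^ i) *ᵥ m := by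
  choose z hz using hint
  have hcont : Continuous fun t => (fun j => (z t j : ℝ)) := by
    refine Continuous.congr ?_ hz
    fun_prop
  have hconst : z (0 + 1) = z 0 := by
    ext j
    exact intValued_eq_of_continuous (f := fun t => z t j) ((continuous_apply j).comp hcont) _ _
  have h0 := hz 0
  have h1 := hz (0 + 1)
  rw [hconst, ← h0] at h1
  simp only [add_right_comm (0 : ℝ) 1, hGdeg, hHdeg, mulVec_add, Finset.sum_add_distrib,
    map_intCast_mulVec] at h1
  have key : k = A ^ n *ᵥ k + ∑ i ∈ Finset.range n, A ^ (n - 1 - i) *ᵥ m := by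
    ext j
    have hj := congrFun h1 j
    simp only [Pi.sub_apply, Pi.add_apply, Finset.sum_apply] at hj ⊢
    have : (k j : ℝ) = ((A ^ n *ᵥ k) j : ℤ)
        + ∑ i ∈ Finset.range n, (((A ^ (n - 1 - i) *ᵥ m) j : ℤ) : ℝ) := by
      linarith
    exact_mod_cast this
  rw [← Finset.sum_range_reflect, sub_mulVec, one_mulVec, sum_mulVec]
  exact sub_eq_iff_eq_add'.2 key
end

section
/- Let X be a compact metric space without isolated points and let φ : X → X be a homeomorphism admitting a point x₀ whose orbit {φⁿ(x₀) : n ∈ ℤ} is dense in X. Then for any finite family U₁, …, U_p of nonempty open subsets of X there exist an integer m ≥ 1 and points x_i ∈ U_i (1 ≤ i ≤ p) such that φᵐ(x_i) ∈ U_i for every 1 ≤ i ≤ p. (Abstract form of Lemma 4.1: simultaneous return with a common return time.) -/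
theorem Homeomorph.continuous_toEquiv_zpow {X : Type*} [TopologicalSpace X] (e : X ≃ₜ X) (n : ℤ) :
    Continuous (e.toEquiv ^ n : Equiv.Perm X) := by
  have hpow : ∀ (f : X ≃ₜ X) (k : ℕ), Continuous (f.toEquiv ^ k : Equiv.Perm X) := fun f k => by
    rw [Equiv.Perm.coe_pow]
    exact f.continuous.iterate k
  obtain ⟨k, rfl | rfl⟩ := n.eq_nat_or_neg
  · rw [zpow_natCast]
    exact hpow e k
  · rw [zpow_neg, zpow_natCast, ← inv_pow]
    exact hpow e.symm k

/-- If the two-sided orbit of a non-isolated point `x₀` is dense, every neighbourhood of `x₀`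
contains a point that returns to it at a positive time. -/
theorem Homeomorph.exists_return_of_dense_orbit {X : Type*} [TopologicalSpace X] [T1Space X]
    (e : X ≃ₜ X) {x₀ : X} (hx₀ : Filter.NeBot (nhdsWithin x₀ {x₀}ᶜ))
    (hdense : Dense (Set.range fun n : ℤ => (e.toEquiv ^ n) x₀))
    {V : Set X} (hV : IsOpen V) (hmem : x₀ ∈ V) :
    ∃ m : ℕ, 1 ≤ m ∧ ∃ y ∈ V, (e.toEquiv ^ m) y ∈ V := by
  have hne : (V ∩ {x₀}ᶜ).Nonempty :=
    hx₀.nonempty_of_mem (Filter.inter_mem (mem_nhdsWithin_of_mem_nhds (hV.mem_nhds hmem)) self_mem_nhdsWithin)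
  obtain ⟨_, ⟨hkV, hk⟩, k, rfl⟩ :=
    hdense.inter_open_nonempty _ (hV.inter isOpen_compl_singleton) hne
  have hk0 : k ≠ 0 := by
    rintro rfl
    exact hk (by simp)
  obtain ⟨m, rfl | rfl⟩ := k.eq_nat_or_neg
  · exact ⟨m, by omega, x₀, hmem, by simpa using hkV⟩
  · exact ⟨m, by omega, _, hkV, by simpa using hmem⟩

/-- abstract form of Lemma 4.1: let X be a compact metric space without
isolated points and e : X → X a homeomorphism having a point x₀ with dense two-sided
orbit {eⁿ(x₀) : n ∈ ℤ}.  Then for any finite family of nonempty open sets U₁,…,U_p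
there are m ≥ 1 and points xᵢ ∈ Uᵢ with eᵐ(xᵢ) ∈ Uᵢ for all i. -/
theorem simultaneous_return {X : Type*} [MetricSpace X] [CompactSpace X]
    (hX : ∀ x : X, Filter.NeBot (nhdsWithin x {x}ᶜ))
    (e : X ≃ₜ X) (x₀ : X)
    (hdense : Dense (Set.range fun n : ℤ => (e.toEquiv ^ n) x₀))
    (p : ℕ) (U : Fin p → Set X)
    (hopen : ∀ i, IsOpen (U i)) (hne : ∀ i, (U i).Nonempty) :
    ∃ m : ℕ, 1 ≤ m ∧ ∃ x : Fin p → X, ∀ i, x i ∈ U i ∧ (⇑e)^[m] (x i) ∈ U i := by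
  have hvisit : ∀ i, ∃ n : ℤ, (e.toEquiv ^ n) x₀ ∈ U i := fun i => by
    obtain ⟨_, hU, n, rfl⟩ := hdense.inter_open_nonempty _ (hopen i) (hne i)
    exact ⟨n, hU⟩
  choose n hn using hvisit
  obtain ⟨m, hm, y, hy, hmy⟩ := e.exists_return_of_dense_orbit (hX x₀) hdense
    (isOpen_iInter_of_finite fun i => (hopen i).preimage (e.continuous_toEquiv_zpow (n i)))
    (Set.mem_iInter.2 hn)
  refine ⟨m, hm, fun i => (e.toEquiv ^ n i) y, fun i => ⟨Set.mem_iInter.1 hy i, ?_⟩⟩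
  have hcomm : (e.toEquiv ^ m) ((e.toEquiv ^ n i) y) = (e.toEquiv ^ n i) ((e.toEquiv ^ m) y) := by
    rw [← Equiv.Perm.mul_apply, ← Equiv.Perm.mul_apply,
      (((Commute.refl e.toEquiv).zpow_right (n i)).pow_left m).eq]
  have hiter : (⇑e)^[m] = ⇑(e.toEquiv ^ m) := (Equiv.Perm.coe_pow e.toEquiv m).symm
  rw [hiter, hcomm]
  exact Set.mem_iInter.1 hmy i
end

section
/- Let Ω be a compact metric space containing at least two points, and let M be a nonempty connected topological manifold (locally Euclidean, Hausdorff, second countable, without boundary). Then for every continuous map g : Ω → M, every point ω₀ ∈ Ω, and every x ∈ M, there exist a nonempty open set A ⊆ Ω with ω₀ ∉ A and a continuous map g' : Ω → M such that g'(ω₀) = x and g'(ω) = g(ω) for all ω ∈ A. (Lemma 4.4.) -/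
open scoped Topology in
/-- A continuous map into a space locally modelled on a normed space can be modified near a point
so as to become constant close to that point, without changing it away from the point. -/
theorem exists_continuous_const_near {X M : Type*} (E : Type*) [MetricSpace X] [Nontrivial X]
    [NormedAddCommGroup E] [NormedSpace ℝ E] [TopologicalSpace M] [ChartedSpace E M]
    {g : X → M} (hg : Continuous g) (a : X) :
    ∃ (k : X → M) (r : ℝ), 0 < r ∧ Continuous k ∧
      (∀ b, (dist b a ≤ r / 2 → k b = g a) ∧ (r < dist b a → k b = g b)) ∧
      {b | r < dist b a}.Nonempty := by
  let e := chartAt E (g a)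
  have hs : g a ∈ e.source := mem_chart_source E (g a)
  obtain ⟨ε, hε, hball⟩ := Metric.isOpen_iff.mp e.open_target _ (e.map_source hs)
  have hnhds : g ⁻¹' (e.source ∩ e ⁻¹' Metric.ball (e (g a)) ε) ∈ 𝓝 a :=
    hg.continuousAt.preimage_mem_nhds <| Filter.inter_mem (e.open_source.mem_nhds hs)
      ((e.continuousAt hs).preimage_mem_nhds (Metric.ball_mem_nhds _ hε))
  obtain ⟨δ, hδ, hsub⟩ := Metric.nhds_basis_closedBall.mem_iff.mp hnhds
  obtain ⟨b₁, hb₁⟩ := exists_ne a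
  have hd : 0 < dist b₁ a := dist_pos.mpr hb₁
  obtain ⟨r, hr, hr'⟩ := exists_between (lt_min hδ hd)
  have hr_sub : ∀ b, dist b a ≤ r → g b ∈ e.source ∧ e (g b) ∈ Metric.ball (e (g a)) ε :=
    fun b hb ↦ hsub (hb.trans (hr'.le.trans (min_le_left _ _)))
  let s : X → ℝ := fun b ↦ max 0 (2 * dist b a / r - 1)
  have hs_cont : Continuous s := by fun_prop
  let c : X → E := fun b ↦ AffineMap.lineMap (e (g a)) (e (g b)) (s b)
  have hc_mem : ∀ b, dist b a ≤ r → c b ∈ e.target := fun b hb ↦ by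
    refine hball ((convex_ball (e (g a)) ε).lineMap_mem (Metric.mem_ball_self hε)
      (hr_sub b hb).2 ⟨le_max_left _ _, max_le zero_le_one ?_⟩)
    have : 2 * dist b a / r ≤ 2 := by rw [div_le_iff₀ hr]; linarith
    linarith
  have hc_cont : ContinuousOn c {b | dist b a ≤ r} := by
    have h : ContinuousOn (fun b ↦ e (g b)) {b | dist b a ≤ r} :=
      e.continuousOn.comp hg.continuousOn fun b hb ↦ (hr_sub b hb).1
    simp only [c, AffineMap.lineMap_apply_module]
    exact ((continuous_const.sub hs_cont).continuousOn.smul continuousOn_const).add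
      (hs_cont.continuousOn.smul h)
  refine ⟨fun b ↦ if dist b a ≤ r then e.symm (c b) else g b, r, hr, ?_, fun b ↦ ⟨fun hb ↦ ?_,
    fun hb ↦ by simp [hb.not_ge]⟩, b₁, hr'.trans_le (min_le_right _ _)⟩
  · refine continuous_if_le (by fun_prop) continuous_const
      (e.continuousOn_symm.comp hc_cont hc_mem) hg.continuousOn fun b hb ↦ ?_
    have h1 : s b = 1 := by
      simp only [s, hb]
      rw [mul_div_cancel_right₀ _ hr.ne']
      norm_num
    simp only [c, h1, AffineMap.lineMap_apply_one]
    exact e.left_inv (hr_sub b hb.le).1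
  · have h0 : s b = 0 := by
      have : 2 * dist b a / r ≤ 1 := by rw [div_le_iff₀ hr]; linarith
      exact max_eq_left (by linarith)
    have hbr : dist b a ≤ r := by linarith
    simp only [hbr, if_true, c, h0, AffineMap.lineMap_apply_zero]
    exact e.left_inv hs

/-- Lemma 4.4: let Ω be a compact metric space with at least two points
and M a nonempty connected topological manifold without boundary (locally Euclidean,
Hausdorff, second countable).  For every continuous g : Ω → M, every ω₀ ∈ Ω and every
x ∈ M there are a nonempty open set A ⊆ Ω with ω₀ ∉ A and a continuous g' : Ω → M with
g'(ω₀) = x and g' = g on A. -/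
theorem modify_continuous_map {Ω : Type*} [MetricSpace Ω] [CompactSpace Ω] [Nontrivial Ω]
    {M : Type*} [TopologicalSpace M] [T2Space M] [SecondCountableTopology M]
    [Nonempty M] [ConnectedSpace M]
    (n : ℕ) [ChartedSpace (EuclideanSpace ℝ (Fin n)) M]
    (g : Ω → M) (hg : Continuous g) (ω₀ : Ω) (x : M) :
    ∃ A : Set Ω, IsOpen A ∧ A.Nonempty ∧ ω₀ ∉ A ∧
      ∃ g' : Ω → M, Continuous g' ∧ g' ω₀ = x ∧ ∀ ω ∈ A, g' ω = g ω := by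
  have : LocallyPathConnectedSpace M :=
    ChartedSpace.locallyPathConnectedSpace (EuclideanSpace ℝ (Fin n)) M
  have : PathConnectedSpace M := pathConnectedSpace_iff_connectedSpace.mpr inferInstance
  obtain ⟨k, r, hr, hk, hk_eq, hA⟩ := exists_continuous_const_near (EuclideanSpace ℝ (Fin n)) hg ω₀
  let γ : Path x (g ω₀) := PathConnectedSpace.somePath x (g ω₀)
  refine ⟨{ω | r < dist ω ω₀}, isOpen_lt continuous_const (by fun_prop), hA,
    by simp [hr.le], fun ω ↦ if dist ω ω₀ ≤ r / 2 then γ.extend (2 * dist ω ω₀ / r) else k ω,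
    ?_, by simp [(half_pos hr).le], fun ω hω ↦ ?_⟩
  · refine continuous_if_le (by fun_prop) continuous_const
      (γ.continuous_extend.comp (by fun_prop)).continuousOn hk.continuousOn fun ω hω ↦ ?_
    have h1 : 2 * dist ω ω₀ / r = 1 := by rw [hω]; field_simp
    rw [h1, γ.extend_one, (hk_eq ω).1 hω.le]
  · have hω' : r < dist ω ω₀ := hω
    have h2 : ¬ dist ω ω₀ ≤ r / 2 := by linarith
    simp only [h2, if_false]
    exact (hk_eq ω).2 hω'
end

section
/- Let X be a nonempty compact topological space having exactly k connected components C₁, …, C_k, and let φ : X → X be a homeomorphism admitting a point whose orbit {φⁿ(x₀) : n ∈ ℤ} is dense in X. Then there is a unique permutation τ of {1, …, k} with φ(C_i) = C_{τ(i)} for all i, and τ is a single k-cycle; equivalently, after relabeling the components one has φ(C_i) = C_{(i mod k)+1} for all i. (Topological part of the Spectral Decomposition Theorem 2.4.) -/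
theorem Homeomorph.image_connectedComponent_eq {X Y : Type*} [TopologicalSpace X]
    [TopologicalSpace Y] (e : X ≃ₜ Y) (x : X) :
    e '' connectedComponent x = connectedComponent (e x) := by
  apply Set.Subset.antisymm (e.continuous.image_connectedComponent_subset x)
  rw [e.image_eq_preimage_symm]
  have h := e.symm.continuous.mapsTo_connectedComponent (e x)
  rwa [e.symm_apply_apply] at h

theorem isOpen_connectedComponent_of_finite_range {X : Type*} [TopologicalSpace X]
    (h : (Set.range (connectedComponent : X → Set X)).Finite) (x : X) :
    IsOpen (connectedComponent x) := by
  have hcompl : (connectedComponent x)ᶜ =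
      ⋃₀ (Set.range (connectedComponent : X → Set X) \ {connectedComponent x}) := by
    ext y
    constructor
    · exact fun hy => ⟨connectedComponent y,
        ⟨⟨y, rfl⟩, fun hxy => hy (hxy ▸ mem_connectedComponent)⟩, mem_connectedComponent⟩
    · rintro ⟨_, ⟨⟨z, rfl⟩, hz⟩, hyz⟩ hyx
      exact hz ((connectedComponent_eq hyz).trans (connectedComponent_eq hyx).symm)
  rw [← isClosed_compl_iff, hcompl, Set.sUnion_eq_biUnion]
  refine h.sdiff.isClosed_biUnion ?_
  rintro _ ⟨⟨z, rfl⟩, -⟩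
  exact isClosed_connectedComponent

theorem Equiv.Perm.IsCycleOn.exists_perm_conj_add_one {k : ℕ} [NeZero k]
    {τ : Equiv.Perm (Fin k)} (hτ : τ.IsCycleOn ((Finset.univ : Finset (Fin k)) : Set (Fin k))) :
    ∃ σ : Equiv.Perm (Fin k), ∀ i, τ (σ i) = σ (i + 1) := by
  have hsurj : Function.Surjective fun j : Fin k => (τ ^ (j : ℕ)) 0 := fun b => by
    obtain ⟨n, hn, h⟩ := hτ.exists_pow_eq (Finset.mem_univ (0 : Fin k)) (Finset.mem_univ b)
    exact ⟨⟨n, by simpa using hn⟩, h⟩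
  refine ⟨Equiv.ofBijective _ (Finite.surjective_iff_bijective.1 hsurj), fun i => ?_⟩
  change τ ((τ ^ (i : ℕ)) 0) = (τ ^ ((i + 1 : Fin k) : ℕ)) 0
  rw [← Equiv.Perm.mul_apply, ← pow_succ',
    hτ.pow_apply_eq_pow_apply (Finset.mem_univ (0 : Fin k)), Finset.card_univ, Fintype.card_fin]
  simp [Nat.ModEq, Fin.val_add]

/-- topological part of the Spectral Decomposition Theorem 2.4: let X be
a nonempty compact space with exactly k connected components C₁,…,C_k and e : X → X a
homeomorphism with a dense two-sided orbit.  Then there is a unique permutation τ of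
{1,…,k} with e(Cᵢ) = C_{τ(i)} for all i, and τ is a single k-cycle: after relabeling
the components by some permutation σ, one has e(C_{σ(i)}) = C_{σ(i+1 mod k)}. -/
theorem spectral_decomposition_components {X : Type*} [TopologicalSpace X]
    [CompactSpace X] [Nonempty X]
    (k : ℕ) [NeZero k] (C : Fin k → Set X) (hCinj : Function.Injective C)
    (hCcomp : ∀ i, ∃ x : X, C i = connectedComponent x)
    (hCall : ∀ x : X, ∃ i, connectedComponent x = C i)
    (e : X ≃ₜ X) (x₀ : X)
    (hdense : Dense (Set.range fun n : ℤ => (e.toEquiv ^ n) x₀)) :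
    (∃! τ : Equiv.Perm (Fin k), ∀ i, ⇑e '' C i = C (τ i)) ∧
      ∃ σ : Equiv.Perm (Fin k), ∀ i : Fin k, ⇑e '' C (σ i) = C (σ (i + 1)) := by
  choose c hc using hCall
  choose x hx using hCcomp
  have hcx (i) : c (x i) = i := hCinj ((hc _).symm.trans (hx i).symm)
  have himage (y : X) : e '' C (c y) = C (c (e y)) := by
    rw [← hc, e.image_connectedComponent_eq, hc]
  have hmap (i) : e '' C i = C (c (e (x i))) := by rw [← himage, hcx]
  have hinj : Function.Injective fun i => c (e (x i)) := fun i j hij =>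
    hCinj (e.injective.image_injective (by rw [hmap, hmap]; exact congrArg C hij))
  let τ : Equiv.Perm (Fin k) := Equiv.ofBijective _ (Finite.injective_iff_bijective.1 hinj)
  have hτ (i) : e '' C i = C (τ i) := hmap i
  have hsemi (y : X) : c (e y) = τ (c y) := hCinj (by rw [← himage, hτ])
  have hpow (n : ℤ) : c ((e.toEquiv ^ n) x₀) = (τ ^ n) (c x₀) := by
    induction n with
    | zero => rfl
    | succ n ih =>
      rw [add_comm, zpow_one_add, zpow_one_add, Equiv.Perm.mul_apply, Equiv.Perm.mul_apply, ← ih]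
      exact hsemi _
    | pred n ih =>
      apply τ.injective
      rw [← Equiv.Perm.mul_apply, ← zpow_one_add, ← hsemi, add_sub_cancel, ← ih]
      change c ((e.toEquiv * e.toEquiv ^ (-(n : ℤ) - 1)) x₀) = _
      rw [← zpow_one_add, add_sub_cancel]
  have hfin : (Set.range (connectedComponent : X → Set X)).Finite :=
    (Set.finite_range C).subset (by rintro _ ⟨y, rfl⟩; exact ⟨c y, (hc y).symm⟩)
  have hsame (i) : τ.SameCycle (c x₀) i := by
    obtain ⟨_, hy, n, rfl⟩ := hdense.inter_open_nonempty _
      (isOpen_connectedComponent_of_finite_range hfin (x i)) ⟨x i, mem_connectedComponent⟩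
    refine ⟨n, ?_⟩
    rw [← hpow]
    apply hCinj
    rw [← hc, hx]
    exact (connectedComponent_eq hy).symm
  refine ⟨⟨τ, hτ, fun τ' hτ' => Equiv.ext fun i => hCinj ((hτ' i).symm.trans (hτ i))⟩, ?_⟩
  have hcycle : τ.IsCycleOn ((Finset.univ : Finset (Fin k)) : Set (Fin k)) :=
    ⟨by simp, fun i _ j _ => (hsame i).symm.trans (hsame j)⟩
  obtain ⟨σ, hσ⟩ := hcycle.exists_perm_conj_add_one
  exact ⟨σ, fun i => by rw [hτ, hσ]⟩
end
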